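/- arXiv:2008.01899 — 6 statements merged into one kernel-verified Lean document; each statement's English description precedes it below -/
import Mathlib

section
/- Let H be a nontrivial real normed space, let p > 4 and a, c, μ > 0, and set δ = μ(p−4)·c^{−2/(p−4)}·(a/(2p−4))^{(p−2)/(p−4)} and ρ_a = (a/((2p−4)c))^{1/(p−4)}. Let 0 < λ < μ + δ and let J : H → ℝ satisfy J(u) ≥ (a/4)‖u‖⁴ + (1/2)(1 − λ/μ)‖u‖² − c‖u‖^p for all u ∈ H. Assume there exist φ ∈ H with ‖φ‖ = 1 and constants m ∈ ℝ and k > 0 such that J(tφ) ≤ (a/4)t⁴ + m t² − k t^p for all t > 0. Then inf{J(u) : ‖u‖ = ρ_a} > 0, and there exists e₀ ∈ H with ‖e₀‖ > ρ_a and J(e₀) < 0. -/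
/-- A quartic-quadratic polynomial minus a positive multiple of `t ^ p` with `p > 4` is eventually
negative. -/
theorem eventually_quartic_sub_rpow_neg {p k : ℝ} (hp : 4 < p) (hk : 0 < k) (b m : ℝ) :
    ∀ᶠ t : ℝ in Filter.atTop, b * t ^ 4 + m * t ^ 2 - k * t ^ p < 0 := by
  have hq : 0 < p - 4 := by linarith
  filter_upwards [(tendsto_rpow_atTop hq).eventually_gt_atTop ((b + |m|) / k),
    Filter.eventually_ge_atTop (1 : ℝ)] with t ht ht1
  have ht0 : 0 < t := by linarith
  have hpow : t ^ p = t ^ (p - 4) * t ^ 4 := by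
    rw [← Real.rpow_natCast t 4, ← Real.rpow_add ht0]
    norm_num
  have hm : m * t ^ 2 ≤ |m| * t ^ 4 :=
    mul_le_mul (le_abs_self m) (pow_le_pow_right₀ ht1 (by norm_num)) (by positivity)
      (abs_nonneg m)
  have hkt : b + |m| < t ^ (p - 4) * k := (div_lt_iff₀ hk).mp ht
  have h4 : 0 < t ^ 4 := by positivity
  rw [hpow]
  nlinarith [mul_lt_mul_of_pos_right hkt h4]

/-- At the radius `r = (B / c) ^ (1 / (p - 4))` one has `c * r ^ p = B * r ^ 4`. -/
theorem mul_rpow_radius {p B c : ℝ} (hp : 4 < p) (hB : 0 < B) (hc : 0 < c) :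
    c * ((B / c) ^ (1 / (p - 4))) ^ p = B * ((B / c) ^ (1 / (p - 4))) ^ 4 := by
  have hq : p - 4 ≠ 0 := by linarith
  have hr : 0 < (B / c) ^ (1 / (p - 4)) := by positivity
  have h : ((B / c) ^ (1 / (p - 4))) ^ (p - 4) = B / c := by
    rw [one_div, Real.rpow_inv_rpow (by positivity) hq]
  set r := (B / c) ^ (1 / (p - 4))
  have hpow : r ^ p = r ^ (p - 4) * r ^ 4 := by
    rw [← Real.rpow_natCast r 4, ← Real.rpow_add hr]
    norm_num
  rw [hpow, h]
  field_simp

/-- The square of the radius `(B / c) ^ (1 / (p - 4))`, multiplied by `B`. -/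
theorem mul_sq_radius {p B c : ℝ} (hp : 4 < p) (hB : 0 < B) (hc : 0 < c) :
    B * ((B / c) ^ (1 / (p - 4))) ^ 2 = c ^ (-2 / (p - 4)) * B ^ ((p - 2) / (p - 4)) := by
  have hq : p - 4 ≠ 0 := by linarith
  have he : (p - 2) / (p - 4) = 1 + 2 / (p - 4) := by
    field_simp
    ring
  rw [← Real.rpow_mul_natCast (by positivity), Real.div_rpow hB.le hc.le, he,
    Real.rpow_add hB, Real.rpow_one, neg_div, Real.rpow_neg hc.le]
  have h2 : 1 / (p - 4) * ((2 : ℕ) : ℝ) = 2 / (p - 4) := by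
    push_cast
    ring
  rw [h2]
  ring

/-- Mountain pass geometry for `p > 4`. -/
theorem stmt2 {H : Type*} [NormedAddCommGroup H] [NormedSpace ℝ H] [Nontrivial H]
    (p a c μ : ℝ) (hp : 4 < p) (ha : 0 < a) (hc : 0 < c) (hμ : 0 < μ)
    (δ ρa : ℝ)
    (hδ : δ = μ * (p - 4) * c ^ (-2 / (p - 4)) * (a / (2 * p - 4)) ^ ((p - 2) / (p - 4)))
    (hρ : ρa = (a / ((2 * p - 4) * c)) ^ (1 / (p - 4)))
    (lam : ℝ) (hlam : 0 < lam) (hlam' : lam < μ + δ)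
    (J : H → ℝ)
    (hJ : ∀ u : H, a / 4 * ‖u‖ ^ 4 + 1 / 2 * (1 - lam / μ) * ‖u‖ ^ 2 - c * ‖u‖ ^ p ≤ J u)
    (φ : H) (hφ : ‖φ‖ = 1) (m k : ℝ) (hk : 0 < k)
    (hfib : ∀ t : ℝ, 0 < t → J (t • φ) ≤ a / 4 * t ^ 4 + m * t ^ 2 - k * t ^ p) :
    0 < sInf (J '' {u : H | ‖u‖ = ρa}) ∧ ∃ e₀ : H, ρa < ‖e₀‖ ∧ J e₀ < 0 := by
  have hA : 0 < 2 * p - 4 := by linarith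
  set B := a / (2 * p - 4) with hBdef
  have hB : 0 < B := by positivity
  have haB : a = B * (2 * p - 4) := by
    rw [hBdef]
    field_simp
  have hρB : ρa = (B / c) ^ (1 / (p - 4)) := by rw [hρ, hBdef, div_div]
  have hρ0 : 0 < ρa := by
    rw [hρB]
    positivity
  have hcp : c * ρa ^ p = B * ρa ^ 4 := by
    rw [hρB]
    exact mul_rpow_radius hp hB hc
  have hδρ : δ = μ * ((p - 4) * (B * ρa ^ 2)) := by
    rw [hδ, hρB, mul_sq_radius hp hB hc]
    ring
  have hquot : lam / μ < 1 + (p - 4) * (B * ρa ^ 2) := by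
    rw [div_lt_iff₀ hμ]
    linarith
  constructor
  · have hpos : 0 < ρa ^ 2 / 2 * (1 + (p - 4) * (B * ρa ^ 2) - lam / μ) :=
      mul_pos (by positivity) (by linarith)
    refine hpos.trans_le (le_csInf ⟨J (ρa • φ), ρa • φ, ?_, rfl⟩ ?_)
    · simp [norm_smul, hφ, abs_of_pos hρ0]
    · rintro _ ⟨u, hu, rfl⟩
      refine le_trans (le_of_eq ?_) (hJ u)
      rw [show ‖u‖ = ρa from hu, hcp, haB]
      ring
  · obtain ⟨t, ht, htρ⟩ := ((eventually_quartic_sub_rpow_neg hp hk (a / 4) m).and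
      (Filter.eventually_gt_atTop ρa)).exists
    have ht0 : 0 < t := hρ0.trans htρ
    refine ⟨t • φ, ?_, (hfib t ht0).trans_lt ht⟩
    simpa [norm_smul, hφ, abs_of_pos ht0] using htρ
end

section
/- Let H be a real normed space, let 2 < p < 4 and a, c, μ > 0 and g₀ > 0, and set λ_a⁺ = μ·(1 − (4−p)·(g₀/(p μ^{p/2}))^{2/(4−p)}·((2p−4)/a)^{(p−2)/(4−p)}). Suppose max{0, λ_a⁺} < λ < μ, that J : H → ℝ satisfies J(u) ≥ (a/4)‖u‖⁴ + (1/2)(1 − λ/μ)‖u‖² − c‖u‖^p for all u ∈ H, and that there exists φ ∈ H with ‖φ‖² = μ and J(tφ) = ((μ−λ)/2)t² + (aμ²/4)t⁴ − (g₀/p)t^p for all t > 0. Then there exists ρ > 0 such that inf{J(u) : ‖u‖ = ρ} > 0 and there exists e₀ ∈ H with ‖e₀‖ > ρ and J(e₀) < 0. -/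
/-- If `λ` exceeds the threshold `μ (1 - (4 - p) B ^ (2 / (4 - p)) k ^ ((p - 2) / (4 - p)))`, with
`B = g₀ / (p μ ^ (p / 2))` and `k = (2 p - 4) / a`, then the fibering map takes a negative value. -/
theorem exists_fibering_neg {p a μ g₀ lam : ℝ} (hp1 : 2 < p) (hp2 : p < 4) (ha : 0 < a)
    (hμ : 0 < μ) (hg : 0 < g₀)
    (hlam : μ * (1 - (4 - p) * (g₀ / (p * μ ^ (p / 2))) ^ (2 / (4 - p)) *
      ((2 * p - 4) / a) ^ ((p - 2) / (4 - p))) < lam) :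
    ∃ t : ℝ, 0 < t ∧ (μ - lam) / 2 * t ^ 2 + a * μ ^ 2 / 4 * t ^ 4 - g₀ / p * t ^ p < 0 := by
  have hp : 0 < p := by linarith
  have h4p : 0 < 4 - p := by linarith
  have hμp : 0 < μ ^ (p / 2) := Real.rpow_pos_of_pos hμ _
  obtain ⟨B, hB⟩ : ∃ B, B = g₀ / (p * μ ^ (p / 2)) := ⟨_, rfl⟩
  obtain ⟨k, hk⟩ : ∃ k, k = (2 * p - 4) / a := ⟨_, rfl⟩
  obtain ⟨r, hr⟩ : ∃ r, r = (p - 2) / (4 - p) := ⟨_, rfl⟩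
  rw [← hB, ← hk, ← hr] at hlam
  have hB0 : 0 < B := by rw [hB]; positivity
  have hk0 : 0 < k := by rw [hk]; exact div_pos (by linarith) ha
  have hr1 : 2 / (4 - p) = 1 + r := by rw [hr]; field_simp; ring
  have hBk : 0 < B * k := mul_pos hB0 hk0
  obtain ⟨w, hw⟩ : ∃ w, w = (B * k) ^ r := ⟨_, rfl⟩
  have hw0 : 0 < w := by rw [hw]; positivity
  obtain ⟨s, hs⟩ : ∃ s, s = B * k * w := ⟨_, rfl⟩
  have hs0 : 0 < s := by rw [hs]; positivity
  have hlam' : μ * (1 - (4 - p) * (B * w)) < lam := by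
    have h : B * w = B ^ (2 / (4 - p)) * k ^ r := by
      rw [hr1, Real.rpow_add hB0, Real.rpow_one, hw, Real.mul_rpow hB0.le hk0.le, mul_assoc]
    rwa [h, ← mul_assoc]
  have hsp : s ^ (p / 2) = s * w := by
    have h1 : s = (B * k) ^ (1 + r) := by rw [Real.rpow_add hBk, Real.rpow_one, hs, hw]
    have h2 : s ^ ((p - 2) / 2) = w := by
      rw [h1, ← Real.rpow_mul hBk.le, hw]
      congr 1
      rw [← hr1, hr]
      field_simp
    rw [show p / 2 = 1 + (p - 2) / 2 by ring, Real.rpow_add hs0, Real.rpow_one, h2]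
  have hsμ : 0 < s / μ := div_pos hs0 hμ
  refine ⟨√(s / μ), Real.sqrt_pos.2 hsμ, ?_⟩
  have h2 : √(s / μ) ^ 2 = s / μ := Real.sq_sqrt hsμ.le
  have h4 : √(s / μ) ^ 4 = (s / μ) ^ 2 := by
    rw [show √(s / μ) ^ 4 = (√(s / μ) ^ 2) ^ 2 by ring, h2]
  have hpow : g₀ / p * √(s / μ) ^ p = B * (s * w) := by
    rw [Real.sqrt_eq_rpow, ← Real.rpow_mul hsμ.le, show 1 / 2 * p = p / 2 by ring,
      Real.div_rpow hs0.le hμ.le, hsp, hB]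
    field_simp
  have hak : a * k = 2 * p - 4 := by rw [hk]; field_simp
  have hsplit : (μ - lam) / 2 * (s / μ) + a * μ ^ 2 / 4 * (s / μ) ^ 2 - B * (s * w) =
      s / (2 * μ) * (μ * (1 - (4 - p) * (B * w)) - lam) := by
    have h : a * s = (2 * p - 4) * (B * w) := by rw [hs, ← hak]; ring
    field_simp
    linear_combination 2 * μ * h
  rw [h2, h4, hpow, hsplit]
  exact mul_neg_of_pos_of_neg (by positivity) (by linarith)


/-- Mountain pass geometry for `2 < p < 4` when `∫ g φ₁^p dx > 0`. -/
theorem stmt7 {H : Type*} [NormedAddCommGroup H] [NormedSpace ℝ H]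
    (p a c μ g₀ : ℝ) (hp1 : 2 < p) (hp2 : p < 4) (ha : 0 < a) (hc : 0 < c) (hμ : 0 < μ)
    (hg : 0 < g₀)
    (lamA : ℝ)
    (hlamA : lamA = μ * (1 - (4 - p) * (g₀ / (p * μ ^ (p / 2))) ^ (2 / (4 - p)) *
      ((2 * p - 4) / a) ^ ((p - 2) / (4 - p))))
    (lam : ℝ) (hlam1 : max 0 lamA < lam) (hlam2 : lam < μ)
    (J : H → ℝ)
    (hJ : ∀ u : H, a / 4 * ‖u‖ ^ 4 + 1 / 2 * (1 - lam / μ) * ‖u‖ ^ 2 - c * ‖u‖ ^ p ≤ J u)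
    (φ : H) (hφ : ‖φ‖ ^ 2 = μ)
    (hfib : ∀ t : ℝ, 0 < t →
      J (t • φ) = (μ - lam) / 2 * t ^ 2 + a * μ ^ 2 / 4 * t ^ 4 - g₀ / p * t ^ p) :
    ∃ ρ : ℝ, 0 < ρ ∧ 0 < sInf (J '' {u : H | ‖u‖ = ρ}) ∧
      ∃ e₀ : H, ρ < ‖e₀‖ ∧ J e₀ < 0 := by
  have hm : 0 < 1 - lam / μ := by rw [sub_pos, div_lt_one hμ]; exact hlam2
  obtain ⟨t, ht, hneg⟩ := exists_fibering_neg hp1 hp2 ha hμ hg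
    (hlamA ▸ (le_max_right 0 lamA).trans_lt hlam1)
  have hφ0 : 0 < ‖φ‖ := by
    refine (norm_nonneg φ).lt_of_ne fun h => hμ.ne ?_
    rw [← hφ, ← h, zero_pow two_ne_zero]
  have he : 0 < ‖t • φ‖ := by rw [norm_smul, Real.norm_of_nonneg ht.le]; positivity
  have hd : 0 < (1 - lam / μ) / (2 * c) := by positivity
  obtain ⟨ρ, hρ, hρe, hρp⟩ : ∃ ρ : ℝ, 0 < ρ ∧ ρ < ‖t • φ‖ ∧
      ρ ^ (p - 2) ≤ (1 - lam / μ) / (2 * c) := by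
    refine ⟨min (‖t • φ‖ / 2) (((1 - lam / μ) / (2 * c)) ^ (p - 2)⁻¹), by positivity,
      (min_le_left _ _).trans_lt (half_lt_self he), ?_⟩
    refine (Real.rpow_le_rpow (by positivity) (min_le_right _ _) (by linarith)).trans_eq ?_
    exact Real.rpow_inv_rpow hd.le (by linarith)
  refine ⟨ρ, hρ, ?_, t • φ, hρe, hfib t ht ▸ hneg⟩
  have hlow : a / 4 * ρ ^ 4 ≤ sInf (J '' {u : H | ‖u‖ = ρ}) := by
    refine le_csInf (Set.Nonempty.image _ ⟨(ρ / ‖φ‖) • φ, ?_⟩) ?_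
    · change ‖(ρ / ‖φ‖) • φ‖ = ρ
      rw [norm_smul, Real.norm_of_nonneg (by positivity),
        div_mul_cancel₀ _ hφ0.ne']
    · rintro _ ⟨u, hu, rfl⟩
      have h := hJ u
      rw [show ‖u‖ = ρ from hu] at h
      have hsplit : ρ ^ p = ρ ^ 2 * ρ ^ (p - 2) := by
        rw [← Real.rpow_natCast, ← Real.rpow_add hρ]
        norm_num
      have hbound : c * ρ ^ p ≤ 1 / 2 * (1 - lam / μ) * ρ ^ 2 := by
        rw [hsplit]
        calc c * (ρ ^ 2 * ρ ^ (p - 2)) ≤ c * (ρ ^ 2 * ((1 - lam / μ) / (2 * c))) := by gcongr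
          _ = 1 / 2 * (1 - lam / μ) * ρ ^ 2 := by field_simp
      linarith
  exact lt_of_lt_of_le (by positivity) hlow
end

section
/- Let 2 < p < 4, let a > 0, μ > 0, g₀ > 0 and λ ∈ ℝ. Set t₀ = ((2p−4)g₀/(a p μ²))^{1/(4−p)} and λ_a⁺ = μ·(1 − (4−p)·(g₀/(p μ^{p/2}))^{2/(4−p)}·((2p−4)/a)^{(p−2)/(4−p)}). Then ((μ−λ)/2)·t₀² + (aμ²/4)·t₀⁴ − (g₀/p)·t₀^p = (t₀²/2)·(λ_a⁺ − λ). In particular this quantity is negative whenever λ > λ_a⁺. -/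
/-- The fibering map identity `J_{a,λ}(t₀φ₁) = (t₀²/2)(λ_a⁺ − λ)`. -/
theorem stmt8 (p a μ g₀ lam : ℝ) (hp1 : 2 < p) (hp2 : p < 4) (ha : 0 < a) (hμ : 0 < μ)
    (hg : 0 < g₀)
    (t₀ lamA : ℝ)
    (ht₀ : t₀ = ((2 * p - 4) * g₀ / (a * p * μ ^ 2)) ^ (1 / (4 - p)))
    (hlamA : lamA = μ * (1 - (4 - p) * (g₀ / (p * μ ^ (p / 2))) ^ (2 / (4 - p)) *
      ((2 * p - 4) / a) ^ ((p - 2) / (4 - p)))) :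
    (μ - lam) / 2 * t₀ ^ 2 + a * μ ^ 2 / 4 * t₀ ^ 4 - g₀ / p * t₀ ^ p
      = t₀ ^ 2 / 2 * (lamA - lam) ∧
    (lamA < lam →
      (μ - lam) / 2 * t₀ ^ 2 + a * μ ^ 2 / 4 * t₀ ^ 4 - g₀ / p * t₀ ^ p < 0) := by
  have hq : 0 < 4 - p := by linarith
  have hp : 0 < p := by linarith
  have hc : 0 < 2 * p - 4 := by linarith
  have hB : 0 < (2 * p - 4) * g₀ / (a * p * μ ^ 2) := by positivity
  have ht : 0 < t₀ := ht₀ ▸ Real.rpow_pos_of_pos hB _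
  have hcrit : a * μ ^ 2 * t₀ ^ 4 = (2 * p - 4) * (g₀ / p) * t₀ ^ p := by
    have hpow : t₀ ^ (4 - p) = (2 * p - 4) * g₀ / (a * p * μ ^ 2) := by
      rw [ht₀, ← Real.rpow_mul hB.le, one_div_mul_cancel hq.ne', Real.rpow_one]
    have hsplit : t₀ ^ 4 = t₀ ^ (4 - p) * t₀ ^ p := by
      rw [← Real.rpow_add ht, sub_add_cancel]
      norm_cast
    rw [hsplit, hpow]
    field_simp
  have hthr : g₀ / p * t₀ ^ p = t₀ ^ 2 * (μ * ((g₀ / (p * μ ^ (p / 2))) ^ (2 / (4 - p)) *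
      ((2 * p - 4) / a) ^ ((p - 2) / (4 - p)))) := by
    have hlog : Real.log t₀ = 1 / (4 - p) * (Real.log (2 * p - 4) + Real.log g₀ -
        (Real.log a + Real.log p + 2 * Real.log μ)) := by
      rw [ht₀, Real.log_rpow hB, Real.log_div (by positivity) (by positivity),
        Real.log_mul hc.ne' hg.ne', Real.log_mul (by positivity) (by positivity),
        Real.log_mul ha.ne' hp.ne', Real.log_pow]
      norm_num
    refine Real.log_injOn_pos (Set.mem_Ioi.2 (by positivity)) (Set.mem_Ioi.2 (by positivity)) ?_
    rw [Real.log_mul (by positivity) (by positivity), Real.log_div hg.ne' hp.ne',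
      Real.log_rpow ht, Real.log_mul (by positivity) (by positivity), Real.log_pow,
      Real.log_mul hμ.ne' (by positivity), Real.log_mul (by positivity) (by positivity),
      Real.log_rpow (by positivity), Real.log_rpow (by positivity),
      Real.log_div hg.ne' (by positivity), Real.log_mul hp.ne' (by positivity),
      Real.log_rpow hμ, Real.log_div hc.ne' ha.ne', hlog]
    push_cast
    field_simp
    ring
  have key : (μ - lam) / 2 * t₀ ^ 2 + a * μ ^ 2 / 4 * t₀ ^ 4 - g₀ / p * t₀ ^ p
      = t₀ ^ 2 / 2 * (lamA - lam) := by
    rw [hlamA]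
    linear_combination hcrit / 4 - (4 - p) / 2 * hthr
  refine ⟨key, fun h => ?_⟩
  rw [key]
  exact mul_neg_of_pos_of_neg (by positivity) (sub_neg.2 h)
end

section
/- Let 2 < p < 4 and let a, c, μ > 0. If 0 < λ < μ·(1 − (4−p)·(c/2)^{2/(4−p)}·((p−2)/a)^{(p−2)/(4−p)}), then a t⁴ + (1 − λ/μ)·t² − c·t^p > 0 for every t > 0. -/
/-- Weighted AM-GM with weights `(p - 2) / 2` and `(4 - p) / 2`, in the scaling for which
the product of powers is a multiple of `t ^ (p - 2)`. -/
theorem mul_rpow_sub_two_le (p a c t : ℝ) (hp1 : 2 < p) (hp2 : p < 4) (ha : 0 < a)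
    (hc : 0 < c) (ht : 0 < t) :
    c * t ^ (p - 2) ≤ a * t ^ 2 + (4 - p) * (c / 2) ^ (2 / (4 - p)) *
      ((p - 2) / a) ^ ((p - 2) / (4 - p)) := by
  have h4 : 0 < 4 - p := by linarith
  have h2 : 0 < p - 2 := by linarith
  have hA : 0 < (p - 2) / a := by positivity
  have amgm := Real.geom_mean_le_arith_mean2_weighted (w₁ := (p - 2) / 2) (w₂ := (4 - p) / 2)
    (p₁ := t ^ 2 / ((p - 2) / a))
    (p₂ := (c / 2) ^ (2 / (4 - p)) * ((p - 2) / a) ^ ((p - 2) / (4 - p)))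
    (by positivity) (by positivity) (by positivity) (by positivity) (by ring)
  have hX : (t ^ 2 / ((p - 2) / a)) ^ ((p - 2) / 2) =
      t ^ (p - 2) / ((p - 2) / a) ^ ((p - 2) / 2) := by
    rw [Real.div_rpow (by positivity) hA.le, ← Real.rpow_natCast t 2, ← Real.rpow_mul ht.le]
    congr 2
    push_cast
    ring
  have hY : ((c / 2) ^ (2 / (4 - p)) * ((p - 2) / a) ^ ((p - 2) / (4 - p))) ^ ((4 - p) / 2) =
      c / 2 * ((p - 2) / a) ^ ((p - 2) / 2) := by
    rw [Real.mul_rpow (by positivity) (by positivity), ← Real.rpow_mul (by positivity),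
      ← Real.rpow_mul hA.le, show 2 / (4 - p) * ((4 - p) / 2) = 1 by field_simp,
      show (p - 2) / (4 - p) * ((4 - p) / 2) = (p - 2) / 2 by field_simp, Real.rpow_one]
  have hprod : t ^ (p - 2) / ((p - 2) / a) ^ ((p - 2) / 2) *
      (c / 2 * ((p - 2) / a) ^ ((p - 2) / 2)) = c / 2 * t ^ (p - 2) := by
    have := (Real.rpow_pos_of_pos hA ((p - 2) / 2)).ne'
    generalize ((p - 2) / a) ^ ((p - 2) / 2) = B at *
    field_simp
  have hw : (p - 2) / 2 * (t ^ 2 / ((p - 2) / a)) = a * t ^ 2 / 2 := by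
    field_simp
  rw [hX, hY, hprod, hw] at amgm
  linarith

/-- Core nonexistence estimate: positivity of the Nehari-type quantity below `Λ_a⁺`. -/
theorem stmt10 (p a c μ lam : ℝ) (hp1 : 2 < p) (hp2 : p < 4) (ha : 0 < a) (hc : 0 < c)
    (hμ : 0 < μ) (hlam : 0 < lam)
    (hlam' : lam < μ * (1 - (4 - p) * (c / 2) ^ (2 / (4 - p)) *
      ((p - 2) / a) ^ ((p - 2) / (4 - p)))) :
    ∀ t : ℝ, 0 < t → 0 < a * t ^ 4 + (1 - lam / μ) * t ^ 2 - c * t ^ p := by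
  intro t ht
  have key := mul_rpow_sub_two_le p a c t hp1 hp2 ha hc ht
  have hdiv := (div_lt_iff₀' hμ).2 hlam'
  have hpow : t ^ p = t ^ 2 * t ^ (p - 2) := by
    rw [← Real.rpow_natCast t 2, ← Real.rpow_add ht]
    congr 1
    push_cast
    ring
  have hpos : 0 < t ^ 2 * (a * t ^ 2 + (1 - lam / μ) - c * t ^ (p - 2)) :=
    mul_pos (by positivity) (by linarith)
  rw [hpow]
  linarith
end

section
/- Let 2 < p < 4 and let b > 0 and c > 0. Set K = (p−2)·(4−p)^{(4−p)/(p−2)}·(c/2)^{2/(p−2)}·b^{(p−4)/(p−2)}. Then c·t^p ≤ b·t² + K·t⁴ for every t ≥ 0, and K is optimal: for every K′ < K there exists t > 0 with c·t^p > b·t² + K′·t⁴. -/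
/-- The optimal constant `K` is characterised by writing `c` as a weighted geometric mean. -/
theorem weighted_geom_mean_optimal_constant {p b c : ℝ} (hp1 : 2 < p) (hp2 : p < 4)
    (hb : 0 < b) (hc : 0 < c) :
    (b / ((4 - p) / 2)) ^ ((4 - p) / 2) *
      (((p - 2) * (4 - p) ^ ((4 - p) / (p - 2)) * (c / 2) ^ (2 / (p - 2)) *
        b ^ ((p - 4) / (p - 2))) / ((p - 2) / 2)) ^ ((p - 2) / 2) = c := by
  have h1 : 0 < p - 2 := by linarith
  have h2 : 0 < 4 - p := by linarith
  have hK : ((p - 2) * (4 - p) ^ ((4 - p) / (p - 2)) * (c / 2) ^ (2 / (p - 2)) *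
        b ^ ((p - 4) / (p - 2))) / ((p - 2) / 2) =
      2 * (4 - p) ^ ((4 - p) / (p - 2)) * (c / 2) ^ (2 / (p - 2)) *
        b ^ ((p - 4) / (p - 2)) := by
    field_simp
  rw [hK]
  apply Real.log_injOn_pos (Set.mem_Ioi.2 (by positivity)) (Set.mem_Ioi.2 hc)
  rw [Real.log_mul (by positivity) (by positivity), Real.log_rpow (by positivity),
    Real.log_rpow (by positivity), Real.log_mul (by positivity) (by positivity),
    Real.log_mul (by positivity) (by positivity), Real.log_mul (by positivity) (by positivity),
    Real.log_rpow (by positivity), Real.log_rpow (by positivity), Real.log_rpow (by positivity),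
    Real.log_div (by positivity) (by positivity), Real.log_div (by positivity) (by positivity),
    Real.log_div (by positivity) (by positivity)]
  field_simp
  ring

/-- The power `t ^ p` as a weighted geometric mean of `t ^ 2` and `t ^ 4`. -/
theorem rpow_mul_rpow_interpolation {p x y t : ℝ} (hx : 0 ≤ x) (hy : 0 ≤ y) (ht : 0 < t) :
    (x * t ^ 2) ^ ((4 - p) / 2) * (y * t ^ 4) ^ ((p - 2) / 2) =
      x ^ ((4 - p) / 2) * y ^ ((p - 2) / 2) * t ^ p := by
  rw [Real.mul_rpow hx (by positivity), Real.mul_rpow hy (by positivity),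
    ← Real.rpow_natCast_mul ht.le, ← Real.rpow_natCast_mul ht.le, mul_mul_mul_comm,
    ← Real.rpow_add ht]
  congr 2
  push_cast
  ring

/-- Sharp three-term Young inequality with optimal constant `K`. -/
theorem stmt15 (p b c : ℝ) (hp1 : 2 < p) (hp2 : p < 4) (hb : 0 < b) (hc : 0 < c)
    (K : ℝ)
    (hK : K = (p - 2) * (4 - p) ^ ((4 - p) / (p - 2)) * (c / 2) ^ (2 / (p - 2)) *
      b ^ ((p - 4) / (p - 2))) :
    (∀ t : ℝ, 0 ≤ t → c * t ^ p ≤ b * t ^ 2 + K * t ^ 4) ∧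
    ∀ K' : ℝ, K' < K → ∃ t : ℝ, 0 < t ∧ b * t ^ 2 + K' * t ^ 4 < c * t ^ p := by
  have h1 : 0 < p - 2 := by linarith
  have h2 : 0 < 4 - p := by linarith
  have hKpos : 0 < K := by rw [hK]; positivity
  have hmean := weighted_geom_mean_optimal_constant hp1 hp2 hb hc
  rw [← hK] at hmean
  have hpow : ∀ t : ℝ, 0 < t → (b / ((4 - p) / 2) * t ^ 2) ^ ((4 - p) / 2) *
      (K / ((p - 2) / 2) * t ^ 4) ^ ((p - 2) / 2) = c * t ^ p := fun t ht => by
    rw [rpow_mul_rpow_interpolation (by positivity) (by positivity) ht, hmean]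
  have hsum : ∀ t : ℝ, (4 - p) / 2 * (b / ((4 - p) / 2) * t ^ 2) +
      (p - 2) / 2 * (K / ((p - 2) / 2) * t ^ 4) = b * t ^ 2 + K * t ^ 4 := fun t => by
    field_simp
  refine ⟨fun t ht => ?_, fun K' hK' => ?_⟩
  · rcases ht.eq_or_lt with rfl | ht
    · simp [Real.zero_rpow (by linarith : p ≠ 0)]
    · rw [← hpow t ht, ← hsum t]
      exact Real.geom_mean_le_arith_mean2_weighted (by positivity) (by positivity)
        (by positivity) (by positivity) (by ring)
  · have hs : 0 < b * (p - 2) / (K * (4 - p)) := by positivity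
    refine ⟨√(b * (p - 2) / (K * (4 - p))), Real.sqrt_pos.2 hs, ?_⟩
    have hsq := Real.sq_sqrt hs.le
    have ht := Real.sqrt_pos.2 hs
    generalize √(b * (p - 2) / (K * (4 - p))) = t at hsq ht ⊢
    have hterms : K / ((p - 2) / 2) * t ^ 4 = b / ((4 - p) / 2) * t ^ 2 := by
      rw [show t ^ 4 = t ^ 2 * t ^ 2 by ring, hsq]
      field_simp
    have hpos : 0 < b / ((4 - p) / 2) * t ^ 2 := by positivity
    have heq : c * t ^ p = b * t ^ 2 + K * t ^ 4 := by
      rw [← hpow t ht, ← hsum t, hterms, ← Real.rpow_add hpos, ← add_mul,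
        show (4 - p) / 2 + (p - 2) / 2 = 1 by ring, Real.rpow_one, one_mul]
    rw [heq]
    gcongr
end

section
/- Let H be a real normed space, let p > 2 with p ≠ 4, let a > 0 and λ ∈ ℝ, and let Q, G : H → ℝ satisfy: Q(su) = s²Q(u) and G(su) = s^p G(u) for all s > 0 and u ∈ H, and sup{|Q(v)| : ‖v‖ = 1} < ∞. Define J(u) = (a/4)‖u‖⁴ + (1/2)‖u‖² − (λ/2)Q(u) − (1/p)G(u) and I(u) = a‖u‖⁴ + ‖u‖² − λQ(u) − G(u). If a sequence (uₙ) in H satisfies J(uₙ) → α for some α ∈ ℝ and I(uₙ) → 0, then (uₙ) is bounded. -/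
open Filter

/-- A quadratically homogeneous function bounded by `M` on the unit sphere is bounded by
`M * ‖v‖ ^ 2` away from the origin. -/
lemma abs_le_mul_norm_sq_of_homogeneous {H : Type*} [NormedAddCommGroup H] [NormedSpace ℝ H]
    {Q : H → ℝ} (hQ : ∀ s : ℝ, 0 < s → ∀ u : H, Q (s • u) = s ^ 2 * Q u)
    {M : ℝ} (hM : ∀ v : H, ‖v‖ = 1 → |Q v| ≤ M) {v : H} (hv : v ≠ 0) :
    |Q v| ≤ M * ‖v‖ ^ 2 := by
  have hpos : 0 < ‖v‖ := norm_pos_iff.mpr hv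
  have hunit : ‖‖v‖⁻¹ • v‖ = 1 := norm_smul_inv_norm (𝕜 := ℝ) hv
  have hscale := hQ ‖v‖ hpos (‖v‖⁻¹ • v)
  rw [smul_inv_smul₀ hpos.ne'] at hscale
  rw [hscale, abs_mul, abs_of_nonneg (sq_nonneg _), mul_comm]
  exact mul_le_mul_of_nonneg_right (hM _ hunit) (sq_nonneg _)

lemma le_one_add_div_of_mul_pow_four_le {c K B t : ℝ} (hc : 0 < c) (hK : 0 ≤ K) (hB : 0 ≤ B)
    (h : c * t ^ 4 ≤ K + B * t ^ 2) : t ≤ 1 + (K + B) / c := by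
  have hdiv : 0 ≤ (K + B) / c := by positivity
  rcases le_total t 1 with ht | ht
  · linarith
  have hsq : 1 ≤ t ^ 2 := one_le_pow₀ ht
  have hct : c * t ^ 2 ≤ K + B := by
    refine le_of_mul_le_mul_right ?_ (by positivity : 0 < t ^ 2)
    nlinarith [mul_le_mul_of_nonneg_left hsq hK]
  have hle : t ≤ (K + B) / c := by
    rw [le_div_iff₀ hc]
    nlinarith
  linarith

/-- Boundedness of Palais–Smale sequences for `p > 2`, `p ≠ 4`, via homogeneity. -/
theorem stmt17 {H : Type*} [NormedAddCommGroup H] [NormedSpace ℝ H]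
    (p a lam : ℝ) (hp : 2 < p) (hp4 : p ≠ 4) (ha : 0 < a)
    (Q G : H → ℝ)
    (hQhom : ∀ s : ℝ, 0 < s → ∀ u : H, Q (s • u) = s ^ 2 * Q u)
    (hGhom : ∀ s : ℝ, 0 < s → ∀ u : H, G (s • u) = s ^ p * G u)
    (hQbdd : ∃ M : ℝ, ∀ v : H, ‖v‖ = 1 → |Q v| ≤ M)
    (J I : H → ℝ)
    (hJ : ∀ u : H, J u = a / 4 * ‖u‖ ^ 4 + 1 / 2 * ‖u‖ ^ 2 - lam / 2 * Q u - 1 / p * G u)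
    (hI : ∀ u : H, I u = a * ‖u‖ ^ 4 + ‖u‖ ^ 2 - lam * Q u - G u)
    (u : ℕ → H) (α : ℝ)
    (hJu : Tendsto (fun n => J (u n)) atTop (nhds α))
    (hIu : Tendsto (fun n => I (u n)) atTop (nhds 0)) :
    ∃ C : ℝ, ∀ n, ‖u n‖ ≤ C := by
  obtain ⟨M, hM⟩ := hQbdd
  obtain ⟨K, hK⟩ := ((hJu.const_mul p).sub hIu).abs.bddAbove_range
  have hK' : ∀ n, |p * J (u n) - I (u n)| ≤ K := fun n => hK ⟨n, rfl⟩
  have hK0 : 0 ≤ K := (abs_nonneg _).trans (hK' 0)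
  have hc : 0 < |a * (p / 4 - 1)| :=
    abs_pos.mpr (mul_ne_zero ha.ne' fun h => hp4 (by linarith))
  have hb : 0 < p / 2 - 1 := by linarith
  have hB0 : 0 ≤ (p / 2 - 1) * (1 + |lam| * |M|) := by positivity
  refine ⟨1 + (K + (p / 2 - 1) * (1 + |lam| * |M|)) / |a * (p / 4 - 1)|, fun n => ?_⟩
  apply le_one_add_div_of_mul_pow_four_le hc hK0 hB0
  by_cases hn : u n = 0
  · simpa [hn] using hK0
  have hQn : |Q (u n)| ≤ |M| * ‖u n‖ ^ 2 :=
    (abs_le_mul_norm_sq_of_homogeneous hQhom hM hn).trans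
      (mul_le_mul_of_nonneg_right (le_abs_self M) (sq_nonneg _))
  have hkey : a * (p / 4 - 1) * ‖u n‖ ^ 4 =
      (p * J (u n) - I (u n)) - (p / 2 - 1) * (‖u n‖ ^ 2 - lam * Q (u n)) := by
    have hp0 : p ≠ 0 := by linarith
    rw [hJ, hI]
    field_simp
    ring
  calc |a * (p / 4 - 1)| * ‖u n‖ ^ 4
      = |(p * J (u n) - I (u n)) - (p / 2 - 1) * (‖u n‖ ^ 2 - lam * Q (u n))| := by
        rw [← hkey, abs_mul _ (‖u n‖ ^ 4), abs_of_nonneg (by positivity : 0 ≤ ‖u n‖ ^ 4)]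
    _ ≤ |p * J (u n) - I (u n)| + (p / 2 - 1) * |‖u n‖ ^ 2 - lam * Q (u n)| := by
        refine (abs_sub _ _).trans_eq ?_
        rw [abs_mul (p / 2 - 1), abs_of_pos hb]
    _ ≤ K + (p / 2 - 1) * (‖u n‖ ^ 2 + |lam| * (|M| * ‖u n‖ ^ 2)) := by
        gcongr
        · exact hK' n
        · refine (abs_sub _ _).trans ?_
          rw [abs_mul, abs_of_nonneg (sq_nonneg ‖u n‖)]
          gcongr
    _ = K + (p / 2 - 1) * (1 + |lam| * |M|) * ‖u n‖ ^ 2 := by ring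
end
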